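/- arXiv:2602.00992 — 2 statements merged into one kernel-verified Lean document; each statement's English description precedes it below -/
import Mathlib

section
/- Let F : E × E → E be a coordinate retraction family that is C³ on a neighborhood of (0, 0), and let G be a normal-coordinate metric family on E. Then there exist constants C > 0 and ε > 0 such that for all u, v, w_y, w_x ∈ E with ‖u‖ ≤ ε, ‖v‖ ≤ ε, ‖w_y‖ ≤ ε, ‖w_x‖ ≤ ε satisfying F(−u, v) = u and, setting δ := F(−u, v/2), satisfying F(δ, w_y) = u and F(δ, w_x) = −u, one has | sqrt(G(δ)(w_y − w_x, w_y − w_x)) − 2‖u‖ | ≤ C‖u‖³. (In Riemann normal coordinates centred at the geodesic midpoint of two configurations q_x, q_y on a smooth Riemannian manifold, q_x and q_y have coordinates −u and u, the true Riemannian distance d(q_x, q_y) equals 2‖u‖, δ is the coordinate of the retraction midpoint, and sqrt(G(δ)(w_y − w_x, w_y − w_x)) is the midpoint retraction distance; hence the midpoint retraction distance approximates the true Riemannian distance with third-order (cubic) accuracy.) -/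
open scoped RealInnerProductSpace

open Set Filter Topology Metric

section Taylor

variable {V W : Type*} [NormedAddCommGroup V] [NormedSpace ℝ V]
  [NormedAddCommGroup W] [NormedSpace ℝ W]

/-- A `C²` function with vanishing derivative at `0` is Lipschitz on small balls about `0`, with
constant proportional to the radius. -/
lemma ContDiffAt.exists_norm_sub_le_of_fderiv_eq_zero {f : V → W} (hf : ContDiffAt ℝ 2 f 0)
    (hf' : fderiv ℝ f 0 = 0) :
    ∃ C > 0, ∃ r > 0, ∀ s ≤ r, ∀ x y : V, ‖x‖ ≤ s → ‖y‖ ≤ s →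
      ‖f x - f y‖ ≤ C * s * ‖x - y‖ := by
  have h1 : ContDiffAt ℝ 1 (fderiv ℝ f) 0 := hf.fderiv_right (by norm_num)
  obtain ⟨K, t, ht, hK⟩ := h1.exists_lipschitzOnWith
  have hd : ∀ᶠ x in 𝓝 (0 : V), DifferentiableAt ℝ f x := by
    filter_upwards [hf.eventually (by simp)] with x hx
    exact hx.differentiableAt (by norm_num)
  obtain ⟨r, hr, hball⟩ := nhds_basis_closedBall.mem_iff.1 (Filter.inter_mem ht hd)
  refine ⟨K + 1, by positivity, r, hr, fun s hs x y hx hy => ?_⟩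
  have hs0 : 0 ≤ s := (norm_nonneg x).trans hx
  have hsub : closedBall (0 : V) s ⊆ closedBall 0 r := closedBall_subset_closedBall hs
  refine (convex_closedBall (0 : V) s).norm_image_sub_le_of_norm_fderiv_le (𝕜 := ℝ)
    (fun z hz => (hball (hsub hz)).2) (fun z hz => ?_) (by simpa using hy) (by simpa using hx)
  have hz' : ‖z‖ ≤ s := by simpa using hz
  have := hK.norm_sub_le (hball (hsub hz)).1 (mem_of_mem_nhds ht)
  rw [hf', sub_zero, sub_zero] at this
  refine this.trans ?_
  gcongr
  simp

/-- The odd part of a `C³` function with vanishing derivative at `0` is of third order. -/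
lemma ContDiffAt.exists_norm_sub_neg_le_pow_three {g : V → W} (hg : ContDiffAt ℝ 3 g 0)
    (hg' : fderiv ℝ g 0 = 0) :
    ∃ C > 0, ∃ r > 0, ∀ w : V, ‖w‖ ≤ r → ‖g w - g (-w)‖ ≤ C * ‖w‖ ^ 3 := by
  have h1 : ContDiffAt ℝ 2 (fderiv ℝ g) 0 := hg.fderiv_right (by norm_num)
  have h1n : ContDiffAt ℝ 2 (fderiv ℝ g) (-0) := by simpa using h1
  have hh : ContDiffAt ℝ 2 (fun w => fderiv ℝ g w + fderiv ℝ g (-w)) 0 :=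
    h1.add (h1n.comp (0 : V) contDiffAt_id.neg)
  have hh' : fderiv ℝ (fun w => fderiv ℝ g w + fderiv ℝ g (-w)) 0 = 0 := by
    have e1 := (h1.differentiableAt (by norm_num)).hasFDerivAt
    have e1n : HasFDerivAt (fderiv ℝ g) (fderiv ℝ (fderiv ℝ g) 0) (-0) := by simpa using e1
    have e2 := e1.add (e1n.comp (0 : V) (hasFDerivAt_id (0 : V)).neg)
    refine e2.fderiv.trans ?_
    ext x y
    simp
  obtain ⟨C, hC, r, hr, H⟩ := hh.exists_norm_sub_le_of_fderiv_eq_zero hh'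
  have hd : ∀ᶠ x in 𝓝 (0 : V), DifferentiableAt ℝ g x := by
    filter_upwards [hg.eventually (by simp)] with x hx
    exact hx.differentiableAt (by norm_num)
  obtain ⟨ρ, hρ, hball⟩ := nhds_basis_closedBall.mem_iff.1 hd
  refine ⟨C, hC, min r ρ, lt_min hr hρ, fun w hw => ?_⟩
  have hderiv : ∀ z ∈ closedBall (0 : V) ‖w‖,
      HasFDerivAt (fun z => g z - g (-z)) (fderiv ℝ g z + fderiv ℝ g (-z)) z := by
    intro z hz
    have hz' : ‖z‖ ≤ ρ := by
      have : ‖z‖ ≤ ‖w‖ := by simpa using hz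
      exact this.trans (hw.trans (min_le_right _ _))
    have d1 : DifferentiableAt ℝ g z := hball (by simpa using hz')
    have d2 : DifferentiableAt ℝ g (-z) := hball (by simpa using hz')
    have := d1.hasFDerivAt.sub (d2.hasFDerivAt.comp z (hasFDerivAt_id z).neg)
    refine this.congr_fderiv ?_
    ext x
    simp
  have := (convex_closedBall (0 : V) ‖w‖).norm_image_sub_le_of_norm_hasFDerivWithin_le
    (C := C * ‖w‖ * ‖w‖) (x := 0) (y := w)
    (fun z hz => (hderiv z hz).hasFDerivWithinAt) (fun z hz => ?_) (by simp) (by simp)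
  · calc ‖g w - g (-w)‖ ≤ C * ‖w‖ * ‖w‖ * ‖w‖ := by simpa using this
      _ = C * ‖w‖ ^ 3 := by ring
  · have hz' : ‖z‖ ≤ ‖w‖ := by simpa using hz
    have := H ‖w‖ (hw.trans (min_le_left _ _)) z 0 hz' (by simp)
    simp only [neg_zero, hg', add_zero, sub_zero] at this
    exact this.trans (by gcongr)

end Taylor

lemma Real.abs_sqrt_sub_le_div {a b : ℝ} (hb : 0 < b) : |√a - b| ≤ |a - b ^ 2| / b := by
  rw [le_div_iff₀ hb]
  rcases le_total 0 a with ha | ha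
  · have h : a - b ^ 2 = (√a - b) * (√a + b) := by
      linear_combination -(Real.sq_sqrt ha)
    rw [h, abs_mul]
    gcongr
    exact (le_add_of_nonneg_left (Real.sqrt_nonneg a)).trans (le_abs_self _)
  · rw [Real.sqrt_eq_zero_of_nonpos ha, zero_sub, abs_neg, abs_of_pos hb, abs_sub_comm]
    exact le_trans (by nlinarith) (le_abs_self _)

section Retraction

variable {E : Type*} [NormedAddCommGroup E]

/-- The remainder of a coordinate retraction family after subtracting its linear part. -/
def retractionRemainder (F : E × E → E) (p : E × E) : E := F p - (p.1 + p.2)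

lemma eq_add_retractionRemainder (F : E × E → E) (z ζ : E) :
    F (z, ζ) = z + ζ + retractionRemainder F (z, ζ) := by
  simp [retractionRemainder]

variable [NormedSpace ℝ E]

lemma contDiffAt_retractionRemainder {F : E × E → E} (hF : ContDiffAt ℝ 3 F (0, 0)) :
    ContDiffAt ℝ 3 (retractionRemainder F) (0, 0) :=
  hF.sub (contDiffAt_fst.add contDiffAt_snd)

lemma fderiv_retractionRemainder {F : E × E → E} (hF : ContDiffAt ℝ 3 F (0, 0))
    (hF0 : ∀ᶠ z in 𝓝 (0 : E), F (z, 0) = z)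
    (hFid : fderiv ℝ (fun ζ : E => F (0, ζ)) 0 = ContinuousLinearMap.id ℝ E) :
    fderiv ℝ (retractionRemainder F) (0, 0) = 0 := by
  have hd := (hF.differentiableAt (by norm_num)).hasFDerivAt
  have h1 : HasFDerivAt (fun z : E => F (z, 0)) _ 0 :=
    hd.comp (f := fun z : E => (z, (0 : E))) (0 : E)
      (hasFDerivAt_prodMk_left (𝕜 := ℝ) (0 : E) (0 : E))
  have h2 : HasFDerivAt (fun ζ : E => F (0, ζ)) _ 0 :=
    hd.comp (f := fun z : E => ((0 : E), z)) (0 : E)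
      (hasFDerivAt_prodMk_right (𝕜 := ℝ) (0 : E) (0 : E))
  have h1' := h1.unique ((hasFDerivAt_id (0 : E)).congr_of_eventuallyEq hF0)
  have h2' := h2.fderiv.symm.trans hFid
  have h3 : HasFDerivAt (retractionRemainder F) _ (0, 0) :=
    hd.sub (hasFDerivAt_fst.add hasFDerivAt_snd)
  refine h3.fderiv.trans (ContinuousLinearMap.prod_ext ?_ ?_)
  · ext x
    simpa [sub_eq_zero] using DFunLike.congr_fun h1' x
  · ext x
    simpa [sub_eq_zero] using DFunLike.congr_fun h2' x

/-- The difference of the two inverse retractions at the retraction midpoint is `2 • u` up to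
third order, while the midpoint itself and the inverse retractions are of first order. -/
lemma exists_norm_midpoint_retraction_sub_le {F : E × E → E} (hF : ContDiffAt ℝ 3 F (0, 0))
    (hF0 : ∀ᶠ z in 𝓝 (0 : E), F (z, 0) = z)
    (hFid : fderiv ℝ (fun ζ : E => F (0, ζ)) 0 = ContinuousLinearMap.id ℝ E) :
    ∃ M > 0, ∃ ε > 0, ∀ u v w_y w_x : E,
      ‖u‖ ≤ ε → ‖v‖ ≤ ε → ‖w_y‖ ≤ ε → ‖w_x‖ ≤ ε →
      F (-u, v) = u →
      F (F (-u, (1 / 2 : ℝ) • v), w_y) = u →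
      F (F (-u, (1 / 2 : ℝ) • v), w_x) = -u →
      ‖F (-u, (1 / 2 : ℝ) • v)‖ ≤ ‖u‖ ∧ ‖w_y - w_x‖ ≤ 8 * ‖u‖ ∧
        ‖(w_y - w_x) - (2 : ℝ) • u‖ ≤ M * ‖u‖ ^ 3 := by
  have hP := contDiffAt_retractionRemainder hF
  have hP' := fderiv_retractionRemainder hF hF0 hFid
  have hFP := eq_add_retractionRemainder F
  set P := retractionRemainder F with hPdef
  obtain ⟨C, hC, r, hr, hLip⟩ :=
    (hP.of_le (by norm_num) : ContDiffAt ℝ 2 P 0).exists_norm_sub_le_of_fderiv_eq_zero hP'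
  have hodd : ∃ D > 0, ∃ r > 0, ∀ w : E, ‖w‖ ≤ r →
      ‖P (0, w) - P (0, -w)‖ ≤ D * ‖w‖ ^ 3 := by
    obtain ⟨D, hD, ρ, hρ, H⟩ :=
      ContDiffAt.exists_norm_sub_neg_le_pow_three (g := P) hP hP'
    refine ⟨D, hD, ρ, hρ, fun w hw => ?_⟩
    simpa using H (0, w) (by simpa using hw)
  obtain ⟨D, hD, ρ, hρ, hodd⟩ := hodd
  obtain ⟨τ, hτ, hzero⟩ := nhds_basis_closedBall.mem_iff.1 hF0
  have hP0 : ∀ z : E, ‖z‖ ≤ τ → P (z, 0) = 0 := by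
    intro z hz
    have : F (z, 0) = z := hzero (by simpa using hz)
    simp [hPdef, retractionRemainder, this]
  obtain ⟨ε, hε, hεr, hερ, hετ, hεC⟩ :
      ∃ ε > 0, ε ≤ r ∧ ε ≤ ρ ∧ ε ≤ τ ∧ C * ε ≤ 1 / 12 := by
    refine ⟨min (min r ρ) (min τ (1 / 12 / C)), by positivity, ?_, ?_, ?_, ?_⟩
    · exact (min_le_left _ _).trans (min_le_left _ _)
    · exact (min_le_left _ _).trans (min_le_right _ _)
    · exact (min_le_right _ _).trans (min_le_left _ _)
    · rw [mul_comm, ← le_div_iff₀ hC]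
      exact (min_le_right _ _).trans (min_le_right _ _)
  -- the remainder is controlled by `max ‖z‖ ‖ζ‖ * ‖ζ‖`
  have hPbd : ∀ (s : ℝ) (z ζ : E), s ≤ ε → ‖z‖ ≤ s → ‖ζ‖ ≤ s →
      ‖P (z, ζ)‖ ≤ C * s * ‖ζ‖ := by
    intro s z ζ hs hz hζ
    have := hLip s (hs.trans hεr) (z, ζ) (z, 0) (by simp [Prod.norm_def, hz, hζ])
      (by simp [Prod.norm_def, hz])
    rw [hP0 z (hz.trans (hs.trans hετ))] at this
    simpa [Prod.norm_def] using this
  refine ⟨320 * C ^ 2 + 64 * D, by positivity, ε / 4, by positivity, ?_⟩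
  intro u v w_y w_x hu hv hy hx hv_eq hy_eq hx_eq
  set δ := F (-u, (1 / 2 : ℝ) • v) with hδ_def
  set s := ‖u‖ with hs_def
  have hs0 : 0 ≤ s := norm_nonneg u
  have hs4 : 4 * s ≤ ε := by linarith
  have hCs : C * s ≤ 1 / 12 := (mul_le_mul_of_nonneg_left (by linarith) hC.le).trans hεC
  have hun : ‖-u‖ = s := norm_neg u
  -- `v` is of first order
  rw [hFP] at hv_eq
  have hv4 : ‖v‖ ≤ 4 * s := by
    have h1 := hPbd ε (-u) v le_rfl (by linarith) (by linarith)
    have h2 : C * ε * ‖v‖ ≤ 1 / 12 * ‖v‖ := by gcongr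
    have h3 : v = (2 : ℝ) • u - P (-u, v) := by
      linear_combination (norm := module) hv_eq
    have h4 := norm_sub_le ((2 : ℝ) • u) (P (-u, v))
    rw [← h3, norm_smul] at h4
    norm_num at h4
    linarith [norm_nonneg v]
  -- the midpoint is of second order
  have hδ2 : ‖δ‖ ≤ 12 * C * s ^ 2 := by
    have h1 := hPbd (4 * s) (-u) v hs4 (by linarith) hv4
    have hv2 : ‖(1 / 2 : ℝ) • v‖ ≤ 2 * s := by
      rw [norm_smul]; norm_num; linarith
    have h2 := hPbd (2 * s) (-u) ((1 / 2 : ℝ) • v) (by linarith) (by linarith) hv2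
    have h3 : δ = P (-u, (1 / 2 : ℝ) • v) - (1 / 2 : ℝ) • P (-u, v) := by
      rw [hδ_def, hFP]
      have : P (-u, v) = (2 : ℝ) • u - v := by
        linear_combination (norm := module) hv_eq
      rw [this]
      module
    rw [h3]
    refine (norm_sub_le _ _).trans ?_
    rw [norm_smul]
    have h1' := h1.trans (mul_le_mul_of_nonneg_left hv4 (by positivity))
    have h2' := h2.trans (mul_le_mul_of_nonneg_left hv2 (by positivity))
    norm_num
    nlinarith
  have hδ1 : ‖δ‖ ≤ s := hδ2.trans (by nlinarith)
  -- inverse retractions are of first order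
  have hw4 : ∀ w e : E, ‖w‖ ≤ ε / 4 → ‖e‖ = s → F (δ, w) = e → ‖w‖ ≤ 4 * s := by
    intro w e hw he hwe
    rw [hFP] at hwe
    have h1 := hPbd ε δ w le_rfl (by linarith) (by linarith)
    have h2 : C * ε * ‖w‖ ≤ 1 / 12 * ‖w‖ := by gcongr
    have h3 : w = e - δ - P (δ, w) := by
      linear_combination (norm := module) hwe
    have h4 := norm_sub_le (e - δ) (P (δ, w))
    rw [← h3] at h4
    linarith [norm_nonneg w, norm_sub_le e δ]
  have hy4 := hw4 w_y u hy rfl hy_eq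
  have hx4 := hw4 w_x (-u) hx hun hx_eq
  have hsq : ∀ w : E, ‖w‖ ≤ 4 * s → ‖P (δ, w)‖ ≤ 16 * C * s ^ 2 := by
    intro w hw
    refine (hPbd (4 * s) δ w hs4 (by linarith) hw).trans
      ((mul_le_mul_of_nonneg_left hw (by positivity)).trans_eq (by ring))
  have hcube : ∀ w : E, ‖w‖ ≤ 4 * s → ‖P (δ, w) - P (0, w)‖ ≤ 48 * C ^ 2 * s ^ 3 := by
    intro w hw
    have h := hLip (4 * s) (hs4.trans hεr) (δ, w) (0, w)
      (by simp only [Prod.norm_def]; exact max_le (by linarith) hw)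
      (by simp only [Prod.norm_def]; exact max_le (by simpa using hs0) hw)
    have h' : ‖((δ, w) : E × E) - (0, w)‖ = ‖δ‖ := by simp [Prod.norm_def]
    rw [h'] at h
    exact h.trans ((mul_le_mul_of_nonneg_left hδ2 (by positivity)).trans_eq (by ring))
  rw [hFP] at hy_eq hx_eq
  have hsum : ‖w_x - -w_y‖ ≤ 56 * C * s ^ 2 := by
    have h : w_x - -w_y = -(δ + δ + (P (δ, w_y) + P (δ, w_x))) := by
      linear_combination (norm := module) hy_eq + hx_eq
    rw [h, norm_neg]
    have h1 := norm_add_le (δ + δ) (P (δ, w_y) + P (δ, w_x))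
    have h2 := norm_add_le δ δ
    have h3 := norm_add_le (P (δ, w_y)) (P (δ, w_x))
    linarith [hsq _ hy4, hsq _ hx4]
  have hrefl : ‖P (0, w_x) - P (0, -w_y)‖ ≤ 224 * C ^ 2 * s ^ 3 := by
    have h := hLip (4 * s) (hs4.trans hεr) (0, w_x) (0, -w_y)
      (by simp only [Prod.norm_def]; exact max_le (by simpa using hs0) hx4)
      (by simp only [Prod.norm_def]; exact max_le (by simpa using hs0) (by simpa using hy4))
    have h' : ‖((0, w_x) : E × E) - (0, -w_y)‖ = ‖w_x - -w_y‖ := by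
      rw [Prod.mk_sub_mk, sub_zero, Prod.norm_mk]; simp
    rw [h'] at h
    exact h.trans ((mul_le_mul_of_nonneg_left hsum (by positivity)).trans_eq (by ring))
  have hodd' : ‖P (0, w_y) - P (0, -w_y)‖ ≤ 64 * D * s ^ 3 := by
    refine (hodd w_y (by linarith)).trans ?_
    calc D * ‖w_y‖ ^ 3 ≤ D * (4 * s) ^ 3 := by gcongr
      _ = 64 * D * s ^ 3 := by ring
  refine ⟨hδ1, (norm_sub_le _ _).trans (by linarith), ?_⟩
  have h : (w_y - w_x) - (2 : ℝ) • u = (P (δ, w_x) - P (0, w_x)) - (P (δ, w_y) - P (0, w_y))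
      + ((P (0, w_x) - P (0, -w_y)) - (P (0, w_y) - P (0, -w_y))) := by
    linear_combination (norm := module) hy_eq - hx_eq
  rw [h]
  have h1 := norm_add_le ((P (δ, w_x) - P (0, w_x)) - (P (δ, w_y) - P (0, w_y)))
    ((P (0, w_x) - P (0, -w_y)) - (P (0, w_y) - P (0, -w_y)))
  have h2 := norm_sub_le (P (δ, w_x) - P (0, w_x)) (P (δ, w_y) - P (0, w_y))
  have h3 := norm_sub_le (P (0, w_x) - P (0, -w_y)) (P (0, w_y) - P (0, -w_y))
  linarith [hcube _ hx4, hcube _ hy4]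

end Retraction

/-- **Third-order accuracy of the midpoint retraction distance (Theorem 1 of the paper).**
In Riemann normal coordinates centred at the geodesic midpoint of two configurations
`q_x, q_y` on a smooth Riemannian manifold, `q_x` and `q_y` have coordinates `-u` and `u`,
and the true Riemannian distance `d(q_x, q_y)` equals `2‖u‖`.  Let `F` be a coordinate
retraction family that is `C³` near `(0, 0)` and `G` a normal-coordinate metric family.
If `v = R⁻¹_{q_x}(q_y)` (i.e. `F (-u, v) = u`), `δ = F (-u, v/2)` is the coordinate of the
retraction midpoint, and `w_y, w_x` are the inverse retractions of `q_y, q_x` at `δ`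
(i.e. `F (δ, w_y) = u` and `F (δ, w_x) = -u`), then the midpoint retraction distance
`sqrt (G δ (w_y - w_x, w_y - w_x))` approximates the true Riemannian distance `2‖u‖`
with third-order (cubic) accuracy. -/
theorem midpoint_retraction_distance_third_order_accuracy
    {E : Type*} [NormedAddCommGroup E] [InnerProductSpace ℝ E] [FiniteDimensional ℝ E]
    (F : E × E → E)
    (hF : ContDiffAt ℝ 3 F (0, 0))
    (hF0 : ∀ᶠ z in nhds (0 : E), F (z, 0) = z)
    (hFid : fderiv ℝ (fun ζ : E => F (0, ζ)) 0 = ContinuousLinearMap.id ℝ E)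
    (G : E → (E →L[ℝ] E →L[ℝ] ℝ))
    (hGsymm : ∀ δ x y, G δ x y = G δ y x)
    (hGsmooth : ContDiffAt ℝ 2 G 0)
    (hG0 : ∀ x y : E, G 0 x y = ⟪x, y⟫)
    (hGderiv : fderiv ℝ G 0 = 0) :
    ∃ C > 0, ∃ ε > 0, ∀ u v w_y w_x : E,
      ‖u‖ ≤ ε → ‖v‖ ≤ ε → ‖w_y‖ ≤ ε → ‖w_x‖ ≤ ε →
      F (-u, v) = u →
      F (F (-u, (1 / 2 : ℝ) • v), w_y) = u →
      F (F (-u, (1 / 2 : ℝ) • v), w_x) = -u →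
      |Real.sqrt (G (F (-u, (1 / 2 : ℝ) • v)) (w_y - w_x) (w_y - w_x)) - 2 * ‖u‖|
        ≤ C * ‖u‖ ^ 3 := by
  obtain ⟨M, hM, ε, hε, hmid⟩ := exists_norm_midpoint_retraction_sub_le hF hF0 hFid
  obtain ⟨K, hK, r, hr, hG⟩ := hGsmooth.exists_norm_sub_le_of_fderiv_eq_zero hGderiv
  refine ⟨32 * K + 5 * M, by positivity, min ε r, by positivity, ?_⟩
  intro u v w_y w_x hu hv hy hx hv_eq hy_eq hx_eq
  have hle : min ε r ≤ ε := min_le_left _ _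
  have hur : ‖u‖ ≤ r := hu.trans (min_le_right _ _)
  obtain ⟨hδ, ha8, ha⟩ := hmid u v w_y w_x (hu.trans hle) (hv.trans hle) (hy.trans hle)
    (hx.trans hle) hv_eq hy_eq hx_eq
  set δ := F (-u, (1 / 2 : ℝ) • v)
  set a := w_y - w_x
  rcases eq_or_ne u 0 with rfl | hu0
  · have ha0 : a = 0 := by simpa using ha8
    simp [ha0]
  have hpos : 0 < ‖u‖ := norm_pos_iff.2 hu0
  refine (Real.abs_sqrt_sub_le_div (by positivity)).trans ?_
  rw [div_le_iff₀ (by positivity)]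
  have hGδ : |G δ a a - ‖a‖ ^ 2| ≤ 64 * K * ‖u‖ ^ 4 := by
    have h := hG ‖u‖ hur δ 0 hδ (by simp)
    rw [sub_zero] at h
    have h' := (G δ - G 0).le_opNorm₂ a a
    rw [sub_apply, sub_apply, hG0,
      real_inner_self_eq_norm_sq, Real.norm_eq_abs] at h'
    calc _ ≤ ‖G δ - G 0‖ * ‖a‖ * ‖a‖ := h'
      _ ≤ (K * ‖u‖ * ‖u‖) * (8 * ‖u‖) * (8 * ‖u‖) := by
        gcongr
        exact h.trans (by gcongr)
      _ = 64 * K * ‖u‖ ^ 4 := by ring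
  have hnorm : |‖a‖ ^ 2 - (2 * ‖u‖) ^ 2| ≤ 10 * M * ‖u‖ ^ 4 := by
    have h2 : ‖(2 : ℝ) • u‖ = 2 * ‖u‖ := by simp [norm_smul]
    have h := abs_norm_sub_norm_le a ((2 : ℝ) • u)
    rw [h2] at h
    rw [sq_sub_sq, abs_mul, abs_of_nonneg (by positivity : 0 ≤ ‖a‖ + 2 * ‖u‖)]
    calc _ ≤ (10 * ‖u‖) * (M * ‖u‖ ^ 3) := by
          gcongr
          · linarith
          · exact h.trans ha
      _ = 10 * M * ‖u‖ ^ 4 := by ring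
  calc _ ≤ |G δ a a - ‖a‖ ^ 2| + |‖a‖ ^ 2 - (2 * ‖u‖) ^ 2| := abs_sub_le _ _ _
    _ ≤ 64 * K * ‖u‖ ^ 4 + 10 * M * ‖u‖ ^ 4 := add_le_add hGδ hnorm
    _ = _ := by ring
end

section
/- Let F : E × E → E be a coordinate retraction family that is C³ on a neighborhood of (0, 0), and let Q : E × E → E denote one half of the second partial Fréchet derivative of F in its second argument at (0, 0). Then for every K > 0 there exist constants C > 0 and ε > 0 such that for all u, δ, w ∈ E with ‖u‖ ≤ ε, ‖δ‖ ≤ K‖u‖², ‖w‖ ≤ ε and F(δ, w) = u, one has ‖w − u + δ + Q(u, u)‖ ≤ C‖u‖³. (That is, the inverse retraction at the near-midpoint base δ satisfies w = u − δ − Q(u, u) + O(‖u‖³); the mixed bilinear distortion term B(δ, u) is itself O(‖u‖³) because ‖δ‖ = O(‖u‖²).) -/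
open Metric in
/-- A function that is `C²` at `x₀` is approximated by its derivative at `x₀` on nearby increments,
with an error controlled by the distance to `x₀` times the length of the increment. -/
theorem ContDiffAt.exists_norm_sub_sub_fderiv_le
    {V W : Type*} [NormedAddCommGroup V] [NormedSpace ℝ V]
    [NormedAddCommGroup W] [NormedSpace ℝ W] {f : V → W} {x₀ : V} (hf : ContDiffAt ℝ 2 f x₀) :
    ∃ L ≥ 0, ∃ r > 0, ∀ ρ < r, ∀ x ∈ closedBall x₀ ρ, ∀ y ∈ closedBall x₀ ρ,
      ‖f x - f y - fderiv ℝ f x₀ (x - y)‖ ≤ L * ρ * ‖x - y‖ := by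
  have hd : ContDiffAt ℝ 1 (fderiv ℝ f) x₀ := hf.fderiv_right (by norm_num)
  obtain ⟨L, t, ht, hL⟩ := hd.exists_lipschitzOnWith
  have hev : ∀ᶠ z in nhds x₀, DifferentiableAt ℝ f z :=
    (hf.eventually (by simp)).mono fun z hz => hz.differentiableAt (by norm_num)
  obtain ⟨r, hr, hball⟩ := Metric.mem_nhds_iff.1 (Filter.inter_mem ht hev)
  refine ⟨L, L.2, r, hr, fun ρ hρ x hx y hy => ?_⟩
  have hsub : closedBall x₀ ρ ⊆ ball x₀ r := closedBall_subset_ball hρ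
  refine (convex_closedBall x₀ ρ).norm_image_sub_le_of_norm_fderiv_le' (𝕜 := ℝ)
    (fun z hz => (hball (hsub hz)).2) (fun z hz => ?_) hy hx
  have h := hL.norm_sub_le (hball (hsub hz)).1 (mem_of_mem_nhds ht)
  exact h.trans (mul_le_mul_of_nonneg_left (mem_closedBall_iff_norm.1 hz) L.2)

open Metric in
/-- Second order Taylor expansion at the origin with a cubic remainder. -/
theorem ContDiffAt.exists_norm_sub_taylor_two_le
    {V W : Type*} [NormedAddCommGroup V] [NormedSpace ℝ V]
    [NormedAddCommGroup W] [NormedSpace ℝ W] {g : V → W} (hg : ContDiffAt ℝ 3 g 0) :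
    ∃ L ≥ 0, ∃ r > 0, ∀ w : V, ‖w‖ < r →
      ‖g w - g 0 - fderiv ℝ g 0 w - (1 / 2 : ℝ) • fderiv ℝ (fderiv ℝ g) 0 w w‖
        ≤ L * ‖w‖ ^ 3 := by
  have hd : ContDiffAt ℝ 2 (fderiv ℝ g) 0 := hg.fderiv_right (by norm_num)
  have hsymm : IsSymmSndFDerivAt ℝ g 0 := hg.isSymmSndFDerivAt (by simp; norm_num)
  obtain ⟨L, hL, r₁, hr₁, hbd⟩ := hd.exists_norm_sub_sub_fderiv_le
  have hev : ∀ᶠ z in nhds (0 : V), DifferentiableAt ℝ g z :=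
    (hg.eventually (by simp)).mono fun z hz => hz.differentiableAt (by norm_num)
  obtain ⟨r₂, hr₂, hball⟩ := Metric.mem_nhds_iff.1 hev
  refine ⟨L, hL, min r₁ r₂, lt_min hr₁ hr₂, fun w hw => ?_⟩
  set A := fderiv ℝ g 0
  set B := fderiv ℝ (fderiv ℝ g) 0
  have hderiv : ∀ z ∈ closedBall (0 : V) ‖w‖, HasFDerivWithinAt
      (fun z => g z - A z - (1 / 2 : ℝ) • B z z) (fderiv ℝ g z - A - B z)
      (closedBall (0 : V) ‖w‖) z := by
    intro z hz
    have hgz : DifferentiableAt ℝ g z :=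
      hball (closedBall_subset_ball (hw.trans_le (min_le_right _ _)) hz)
    have hB : HasFDerivAt (fun z => (1 / 2 : ℝ) • B z z) (B z) z := by
      refine ((B.hasFDerivAt.clm_apply (hasFDerivAt_id z)).const_smul (1 / 2 : ℝ)).congr_fderiv ?_
      ext v
      have : B v z = B z v := hsymm v z
      simp only [smul_apply, add_apply,
        ContinuousLinearMap.comp_apply, ContinuousLinearMap.flip_apply, id,
        ContinuousLinearMap.id_apply, this]
      module
    exact ((hgz.hasFDerivAt.sub A.hasFDerivAt).sub hB).hasFDerivWithinAt
  have hbound : ∀ z ∈ closedBall (0 : V) ‖w‖, ‖fderiv ℝ g z - A - B z‖ ≤ L * ‖w‖ * ‖w‖ := by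
    intro z hz
    have h := hbd ‖w‖ (hw.trans_le (min_le_left _ _)) z hz 0 (by simp)
    rw [sub_zero] at h
    exact h.trans (mul_le_mul_of_nonneg_left (mem_closedBall_zero_iff.1 hz) (by positivity))
  have h := (convex_closedBall (0 : V) ‖w‖).norm_image_sub_le_of_norm_hasFDerivWithin_le
    hderiv hbound (x := 0) (y := w) (by simp) (by simp)
  calc _ = ‖g w - A w - (1 / 2 : ℝ) • B w w - (g 0 - A 0 - (1 / 2 : ℝ) • B 0 0)‖ := by
        congr 1
        simp only [map_zero, smul_zero, sub_zero]
        abel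
    _ ≤ L * ‖w‖ * ‖w‖ * ‖w - 0‖ := h
    _ = L * ‖w‖ ^ 3 := by rw [sub_zero]; ring

/-- **Third-order expansion of the inverse retraction at a near-midpoint base.**
Let `F` be a coordinate retraction family that is `C³` near `(0, 0)` and let `Q` be one half
of the second partial Fréchet derivative of `F` in its second argument at `(0, 0)`.
If `‖δ‖ ≤ K ‖u‖²` and `w` is the inverse retraction of the point with normal coordinate `u`
at base `δ` (i.e. `F (δ, w) = u`), then `w = u - δ - Q (u, u) + O(‖u‖³)`; the mixed bilinear
distortion term `B (δ, u)` is itself `O(‖u‖³)` because `‖δ‖ = O(‖u‖²)`. -/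
theorem inverse_retraction_third_order_expansion
    {E : Type*} [NormedAddCommGroup E] [InnerProductSpace ℝ E] [FiniteDimensional ℝ E]
    (F : E × E → E)
    (hF : ContDiffAt ℝ 3 F (0, 0))
    (hF0 : ∀ᶠ z in nhds (0 : E), F (z, 0) = z)
    (hFid : fderiv ℝ (fun ζ : E => F (0, ζ)) 0 = ContinuousLinearMap.id ℝ E)
    (Q : E →L[ℝ] E →L[ℝ] E)
    (hQ : ∀ x y : E,
      Q x y = (1 / 2 : ℝ) • (fderiv ℝ (fun ζ : E => fderiv ℝ (fun w : E => F (0, w)) ζ) 0 x y)) :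
    ∀ K > 0, ∃ C > 0, ∃ ε > 0, ∀ u δ w : E,
      ‖u‖ ≤ ε → ‖δ‖ ≤ K * ‖u‖ ^ 2 → ‖w‖ ≤ ε → F (δ, w) = u →
      ‖w - u + δ + Q u u‖ ≤ C * ‖u‖ ^ 3 := by
  intro K hK
  have hslice : ContDiffAt ℝ 3 (fun ζ : E => F (0, ζ)) 0 :=
    ContDiffAt.comp (0 : E) (f := fun ζ : E => ((0 : E), ζ)) hF
      (contDiffAt_const.prodMk contDiffAt_id)
  have hbase : ∀ δ : E, fderiv ℝ F (0, 0) (δ, 0) = δ := by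
    intro δ
    have hF' : HasFDerivAt F (fderiv ℝ F (0, 0)) ((0 : E), (0 : E)) :=
      (hF.differentiableAt (by norm_num)).hasFDerivAt
    have h₁ := HasFDerivAt.comp (0 : E) (f := fun z : E => (z, (0 : E))) hF'
      ((hasFDerivAt_id (0 : E)).prodMk (hasFDerivAt_const (0 : E) (0 : E)))
    have h₂ : HasFDerivAt (F ∘ fun z : E => (z, (0 : E))) (ContinuousLinearMap.id ℝ E) 0 :=
      (hasFDerivAt_id (0 : E)).congr_of_eventuallyEq hF0
    simpa using DFunLike.congr_fun (h₁.unique h₂) δ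
  obtain ⟨L, hL, r₁, hr₁, hbaseErr⟩ :=
    (hF.of_le (by norm_num : (2 : WithTop ℕ∞) ≤ 3)).exists_norm_sub_sub_fderiv_le
  obtain ⟨T, hT, r₂, hr₂, htaylor⟩ := hslice.exists_norm_sub_taylor_two_le
  set q := ‖Q‖
  have hq0 : 0 ≤ q := norm_nonneg Q
  set M := 2 * K + 16 * q + 16 * T with hM
  have hM0 : 0 ≤ M := by positivity
  obtain ⟨ε, hε, hε1, hεr₁, hεr₂, hεK, hεqT, hεL⟩ : ∃ ε > 0, ε ≤ 1 ∧ ε < r₁ ∧ ε < r₂ ∧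
      K * ε ≤ 1 ∧ (q + T) * ε ≤ 1 / 4 ∧ L * ε ≤ 1 := by
    have small : ∀ a b : ℝ, 0 < b → ∀ᶠ ε in nhdsWithin (0 : ℝ) (Set.Ioi 0), a * ε < b := by
      intro a b hb
      have : Filter.Tendsto (fun ε : ℝ => a * ε) (nhds 0) (nhds 0) := by
        simpa using (continuous_const_mul a).tendsto (0 : ℝ)
      exact (this.mono_left nhdsWithin_le_nhds).eventually_lt_const hb
    have pos : ∀ᶠ ε in nhdsWithin (0 : ℝ) (Set.Ioi 0), 0 < ε := self_mem_nhdsWithin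
    obtain ⟨ε, h0, h1, h2, h3, h4, h5, h6⟩ := (pos.and
      ((small 1 1 one_pos).and ((small 1 r₁ hr₁).and ((small 1 r₂ hr₂).and
      ((small K 1 one_pos).and ((small (q + T) (1 / 4) (by norm_num)).and
      (small L 1 one_pos))))))).exists
    rw [one_mul] at h1 h2 h3
    exact ⟨ε, h0, h1.le, h2, h3, h4.le, h5.le, h6.le⟩
  refine ⟨5 * q * M + 64 * T + 4 * L * K + 1, by positivity, ε, hε,
    fun u δ w hu hδ hw hFu => ?_⟩
  have ha0 := norm_nonneg u
  have hb0 := norm_nonneg w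
  have hd0 := norm_nonneg δ
  have hδu : ‖δ‖ ≤ ‖u‖ := by
    have : K * ‖u‖ ≤ 1 := (mul_le_mul_of_nonneg_left hu hK.le).trans hεK
    nlinarith
  have hF00 : F (0, 0) = 0 := hF0.self_of_nhds
  have hQw : (1 / 2 : ℝ) • fderiv ℝ (fderiv ℝ (fun ζ : E => F (0, ζ))) 0 w w = Q w w :=
    (hQ w w).symm
  have h₁ : ‖F (0, w) - w - Q w w‖ ≤ T * ‖w‖ ^ 3 := by
    have h := htaylor w (hw.trans_lt hεr₂)
    rw [hQw, hFid] at h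
    simpa [hF00] using h
  have h₂ : ‖F (δ, w) - F (0, w) - δ‖ ≤ L * max ‖δ‖ ‖w‖ * ‖δ‖ := by
    have h := hbaseErr (max ‖δ‖ ‖w‖)
      (max_lt ((hδu.trans hu).trans_lt hεr₁) (hw.trans_lt hεr₁))
      (δ, w) (by simp [Prod.dist_eq])
      (0, w) (by simp [Prod.dist_eq])
    have he : ((δ, w) : E × E) - (0, w) = (δ, 0) := by simp
    rw [he, hbase] at h
    simpa [Prod.norm_def] using h
  set e := w - u + δ + Q w w with he
  have hee : ‖e‖ ≤ T * ‖w‖ ^ 3 + L * max ‖δ‖ ‖w‖ * ‖δ‖ := by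
    have : e = -((F (δ, w) - F (0, w) - δ) + (F (0, w) - w - Q w w)) := by
      rw [he, hFu]; abel
    rw [this, norm_neg, add_comm (T * _)]
    exact (norm_add_le _ _).trans (add_le_add h₂ h₁)
  have hQn : ∀ x y : E, ‖Q x y‖ ≤ q * ‖x‖ * ‖y‖ := Q.le_opNorm₂
  have hmax : L * max ‖δ‖ ‖w‖ ≤ 1 :=
    (mul_le_mul_of_nonneg_left (max_le (hδu.trans hu) hw) hL).trans hεL
  have hw3 : T * ‖w‖ ^ 3 ≤ T * ‖w‖ ^ 2 :=
    mul_le_mul_of_nonneg_left (pow_le_pow_of_le_one hb0 (hw.trans hε1) (by norm_num)) hT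
  have hwu : ‖w‖ ≤ 4 * ‖u‖ := by
    have h₃ : ‖w‖ ≤ ‖e‖ + ‖u‖ + ‖δ‖ + ‖Q w w‖ := by
      have : w = e + u - δ - Q w w := by rw [he]; abel
      calc ‖w‖ = ‖e + u - δ - Q w w‖ := congrArg _ this
        _ ≤ ‖e + u - δ‖ + ‖Q w w‖ := norm_sub_le _ _
        _ ≤ ‖e + u‖ + ‖δ‖ + ‖Q w w‖ := by gcongr; exact norm_sub_le _ _
        _ ≤ _ := by gcongr; exact norm_add_le _ _
    have h₄ : L * max ‖δ‖ ‖w‖ * ‖δ‖ ≤ ‖δ‖ := by nlinarith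
    have h₅ : (q + T) * ‖w‖ ≤ 1 / 4 :=
      (mul_le_mul_of_nonneg_left hw (by positivity)).trans hεqT
    have h₆ : (q + T) * ‖w‖ * ‖w‖ ≤ 1 / 4 * ‖w‖ := mul_le_mul_of_nonneg_right h₅ hb0
    nlinarith [hQn w w]
  have hmax' : max ‖δ‖ ‖w‖ ≤ 4 * ‖u‖ := max_le (by linarith) hwu
  have hLδ : L * max ‖δ‖ ‖w‖ * ‖δ‖ ≤ 4 * L * K * ‖u‖ ^ 3 := by
    calc L * max ‖δ‖ ‖w‖ * ‖δ‖ ≤ L * (4 * ‖u‖) * (K * ‖u‖ ^ 2) := by gcongr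
      _ = _ := by ring
  have hTw : T * ‖w‖ ^ 3 ≤ 64 * T * ‖u‖ ^ 3 := by
    calc T * ‖w‖ ^ 3 ≤ T * (4 * ‖u‖) ^ 3 := by gcongr
      _ = _ := by ring
  have hdiff : ‖w - u‖ ≤ M * ‖u‖ ^ 2 := by
    have h₃ : ‖w - u‖ ≤ ‖e‖ + ‖δ‖ + ‖Q w w‖ := by
      have : w - u = e - δ - Q w w := by rw [he]; abel
      rw [this]
      exact (norm_sub_le _ _).trans (add_le_add_left (norm_sub_le _ _) _)
    have h₄ : L * max ‖δ‖ ‖w‖ * ‖δ‖ ≤ ‖δ‖ := mul_le_of_le_one_left hd0 hmax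
    have h₅ : ‖w‖ ^ 2 ≤ 16 * ‖u‖ ^ 2 := by nlinarith
    have h₆ : (q + T) * ‖w‖ ^ 2 ≤ (q + T) * (16 * ‖u‖ ^ 2) := by gcongr
    rw [hM]
    linarith [hQn w w]
  have hQdiff : ‖Q u u - Q w w‖ ≤ 5 * q * M * ‖u‖ ^ 3 := by
    have : Q u u - Q w w = -(Q (w - u) w + Q u (w - u)) := by
      simp only [map_sub, sub_apply]
      abel
    calc ‖Q u u - Q w w‖ = ‖Q (w - u) w + Q u (w - u)‖ := by rw [this, norm_neg]
      _ ≤ q * ‖w - u‖ * ‖w‖ + q * ‖u‖ * ‖w - u‖ :=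
        (norm_add_le _ _).trans (add_le_add (hQn _ _) (hQn _ _))
      _ ≤ q * (M * ‖u‖ ^ 2) * (4 * ‖u‖) + q * ‖u‖ * (M * ‖u‖ ^ 2) := by gcongr
      _ = _ := by ring
  calc ‖w - u + δ + Q u u‖ = ‖e + (Q u u - Q w w)‖ := by
        congr 1
        rw [he]
        abel
    _ ≤ ‖e‖ + ‖Q u u - Q w w‖ := norm_add_le _ _
    _ ≤ (5 * q * M + 64 * T + 4 * L * K + 1) * ‖u‖ ^ 3 := by
        linarith [pow_nonneg ha0 3]
end
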